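/- Two probability measures μ and ν on ℝ^I (with the product σ-algebra ⊗_{i∈I} 𝓑(ℝ)) have a common underlying copula measure if and only if there exist, on a common probability space (Ω,𝓕,ℙ), stochastic processes X = (X_i)_{i∈I} with law μ and Y = (Y_i)_{i∈I} with law ν such that X_i and Y_i are similarly ordered for every i ∈ I, i.e. (X_i(ω)−X_i(ω'))(Y_i(ω)−Y_i(ω')) ≥ 0 for ℙ⊗ℙ-almost every (ω,ω'). -/

import Mathlib

open MeasureTheory ProbabilityTheory

universe u

/-- The uniform probability measure on `[0,1]`. -/
noncomputable def unif01 : Measure ℝ := (volume : Measure ℝ).restrict (Set.Icc 0 1)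

/-- A copula measure on `ℝ^I`: a probability measure on the product σ-algebra all of whose
one-dimensional marginals are uniform on `[0,1]`. -/
def IsCopulaMeasure {I : Type u} (C : Measure (I → ℝ)) : Prop :=
  IsProbabilityMeasure C ∧ ∀ i : I, C.map (fun ω => ω i) = unif01

/-- The Sklar relation: `C` is an underlying copula measure of `μ`. -/
def SklarRel {I : Type u} (C μ : Measure (I → ℝ)) : Prop :=
  ∀ (J : Finset I) (x : I → ℝ),
    C {u | ∀ j ∈ J, u j ≤ cdf (μ.map (fun ω => ω j)) (x j)} =
      μ {ω | ∀ j ∈ J, ω j ≤ x j}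

theorem pi_ext_Iic {I : Type u} (μ ν : Measure (I → ℝ)) [IsProbabilityMeasure μ]
    [IsProbabilityMeasure ν]
    (h : ∀ (J : Finset I) (x : I → ℝ), μ {ω | ∀ j ∈ J, ω j ≤ x j} = ν {ω | ∀ j ∈ J, ω j ≤ x j}) :
    μ = ν := by
  classical
  set S : Set (Set (I → ℝ)) := {A | ∃ (J : Finset I) (x : I → ℝ), A = {ω | ∀ j ∈ J, ω j ≤ x j}} with hS
  refine ext_of_generate_finite S ?_ ?_ ?_ (by simp)
  · apply le_antisymm
    · refine iSup_le fun i => ?_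
      rw [← measurable_iff_comap_le]
      refine @measurable_of_Iic _ _ _ _ _ (MeasurableSpace.generateFrom S) _ _ _ _ fun a => ?_
      apply MeasurableSpace.measurableSet_generateFrom
      exact ⟨{i}, fun _ => a, by ext; simp⟩
    · apply MeasurableSpace.generateFrom_le
      rintro _ ⟨J, x, rfl⟩
      have : {ω : I → ℝ | ∀ j ∈ J, ω j ≤ x j} = ⋂ j ∈ J, {ω | ω j ≤ x j} := by ext; simp
      rw [this]
      exact Finset.measurableSet_biInter _ fun j _ =>
        measurableSet_le (measurable_pi_apply j) measurable_const
  · rintro _ ⟨J, x, rfl⟩ _ ⟨K, y, rfl⟩ _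
    refine ⟨J ∪ K, fun i => if i ∈ J then (if i ∈ K then min (x i) (y i) else x i) else y i, ?_⟩
    ext ω
    simp only [Set.mem_inter_iff, Set.mem_ofPred_eq, Finset.mem_union]
    constructor
    · rintro ⟨h1, h2⟩ j hj
      split_ifs with a b
      · exact le_min (h1 j a) (h2 j b)
      · exact h1 j a
      · exact h2 j (by tauto)
    · intro h
      refine ⟨fun j hj => ?_, fun j hj => ?_⟩
      · have := h j (Or.inl hj)
        simp only [hj, if_true] at this
        split_ifs at this
        · exact this.trans (min_le_left _ _)
        · exact this
      · have := h j (Or.inr hj)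
        simp only [hj, if_true] at this
        split_ifs at this
        · exact this.trans (min_le_right _ _)
        · exact this
  · rintro _ ⟨J, x, rfl⟩
    exact h J x

/-- quantile function -/
noncomputable def qf (m : Measure ℝ) (u : ℝ) : ℝ := 
  open Classical in if u ∈ Set.Ioo (0:ℝ) 1 then sInf {x | u ≤ cdf m x} else 0

theorem qf_le_iff (m : Measure ℝ) {u : ℝ} (hu : u ∈ Set.Ioo (0:ℝ) 1) (x : ℝ) :
    qf m u ≤ x ↔ u ≤ cdf m x := by
  have hne : {x | u ≤ cdf m x}.Nonempty := by
    obtain ⟨y, hy⟩ := ((tendsto_cdf_atTop m).eventually (lt_mem_nhds hu.2)).exists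
    exact ⟨y, hy.le⟩
  have hbd : BddBelow {x | u ≤ cdf m x} := by
    obtain ⟨y, hy⟩ := ((tendsto_cdf_atBot m).eventually (gt_mem_nhds hu.1)).exists
    refine ⟨y, fun z hz => ?_⟩
    by_contra! hc
    have := monotone_cdf m hc.le
    have hz' : u ≤ cdf m z := hz
    linarith
  rw [qf, if_pos hu]
  constructor
  · intro h
    have h1 : ∀ y, x < y → u ≤ cdf m y := by
      intro y hy
      obtain ⟨z, hz, hzy⟩ := (csInf_lt_iff hbd hne).1 (h.trans_lt hy)
      exact le_trans hz (monotone_cdf m hzy.le)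
    have h2 : Filter.Tendsto (cdf m) (nhdsWithin x (Set.Ioi x)) (nhds (cdf m x)) :=
      ((cdf m).right_continuous x).mono_left (nhdsWithin_mono _ Set.Ioi_subset_Ici_self)
    refine ge_of_tendsto h2 ?_
    filter_upwards [self_mem_nhdsWithin] with y hy using h1 y hy
  · intro h
    exact csInf_le hbd h

theorem qf_mono (m : Measure ℝ) {u v : ℝ} (hu : u ∈ Set.Ioo (0:ℝ) 1) (hv : v ∈ Set.Ioo (0:ℝ) 1)
    (h : u ≤ v) : qf m u ≤ qf m v :=
  (qf_le_iff m hu _).2 (h.trans ((qf_le_iff m hv _).1 le_rfl))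

theorem qf_measurable (m : Measure ℝ) : Measurable (qf m) := by
  refine measurable_of_Iic fun x => ?_
  have : qf m ⁻¹' Set.Iic x = (Set.Ioo 0 1 ∩ Set.Iic (cdf m x)) ∪
      ((Set.Ioo 0 1)ᶜ ∩ {_u | (0:ℝ) ≤ x}) := by
    ext u
    by_cases hu : u ∈ Set.Ioo (0:ℝ) 1
    · have := qf_le_iff m hu x
      simp only [Set.mem_preimage, Set.mem_Iic, Set.mem_union, Set.mem_inter_iff, hu,
        Set.mem_compl_iff]
      tauto
    · simp only [Set.mem_preimage, Set.mem_Iic, Set.mem_union, Set.mem_inter_iff, hu,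
        Set.mem_compl_iff, qf, if_false]
      simp
  rw [this]
  exact (measurableSet_Ioo.inter measurableSet_Iic).union
    (measurableSet_Ioo.compl.inter (MeasurableSet.const _))

theorem real_Iio_qf_le (m : Measure ℝ) [IsProbabilityMeasure m] {t : ℝ}
    (ht : t ∈ Set.Ioo (0:ℝ) 1) : m.real (Set.Iio (qf m t)) ≤ t := by
  have h0 : m (Set.Iio (qf m t)) ≤ ENNReal.ofReal t := by
    have e : m (Set.Iio (qf m t)) = (cdf m).measure (Set.Iio (qf m t)) :=
      congrArg (fun ρ : Measure ℝ => ρ (Set.Iio (qf m t))) (measure_cdf m).symm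
    rw [e, StieltjesFunction.measure_Iio _ (tendsto_cdf_atBot m)]
    apply ENNReal.ofReal_le_ofReal
    rw [sub_zero]
    refine le_of_tendsto ((monotone_cdf m).tendsto_leftLim _) ?_
    filter_upwards [self_mem_nhdsWithin] with y hy
    by_contra! hc
    exact absurd ((qf_le_iff m ht y).2 hc.le) (not_le.2 hy)
  exact ENNReal.toReal_le_of_le_ofReal ht.1.le h0

instance : IsProbabilityMeasure unif01 := ⟨by simp [unif01]⟩

theorem unif01_Iic {c : ℝ} (h1 : c ≤ 1) : unif01 (Set.Iic c) = ENNReal.ofReal c := by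
  rw [unif01, Measure.restrict_apply measurableSet_Iic]
  have : Set.Iic c ∩ Set.Icc 0 1 = Set.Icc 0 c := by
    ext x; simp only [Set.mem_inter_iff, Set.mem_Iic, Set.mem_Icc]
    constructor
    · tauto
    · rintro ⟨a, b⟩; exact ⟨b, a, b.trans h1⟩
  rw [this]; simp

theorem unif01_Ioo : ∀ᵐ u ∂unif01, u ∈ Set.Ioo (0:ℝ) 1 := by
  rw [unif01, ← Measure.restrict_congr_set Ioo_ae_eq_Icc]
  exact ae_restrict_mem measurableSet_Ioo

theorem forward_law {I : Type u} (C μ : Measure (I → ℝ)) [IsProbabilityMeasure μ]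
    (hC : IsCopulaMeasure C) (hS : SklarRel C μ) :
    C.map (fun u i => qf (μ.map (fun ω => ω i)) (u i)) = μ := by
  have := hC.1
  have hm : Measurable (fun (u : I → ℝ) i => qf (μ.map (fun ω => ω i)) (u i)) :=
    measurable_pi_lambda _ fun i => (qf_measurable _).comp (measurable_pi_apply i)
  have : IsProbabilityMeasure (C.map (fun u i => qf (μ.map (fun ω => ω i)) (u i))) :=
    Measure.isProbabilityMeasure_map hm.aemeasurable
  refine pi_ext_Iic _ _ fun J x => ?_
  rw [← hS J x, Measure.map_apply hm]
  · apply measure_congr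
    have : ∀ᵐ u ∂C, ∀ j ∈ J, u j ∈ Set.Ioo (0:ℝ) 1 := by
      rw [Filter.eventually_all_finset]
      intro j _
      have := unif01_Ioo
      rw [← hC.2 j] at this
      exact ae_of_ae_map (measurable_pi_apply j).aemeasurable this
    filter_upwards [this] with u hu
    apply propext
    show (∀ j ∈ J, _) ↔ (∀ j ∈ J, _)
    exact forall₂_congr fun j hj => qf_le_iff _ (hu j hj) _
  · have : {ω : I → ℝ | ∀ j ∈ J, ω j ≤ x j} = ⋂ j ∈ J, {ω | ω j ≤ x j} := by ext; simp
    rw [this]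
    exact Finset.measurableSet_biInter _ fun j _ =>
        measurableSet_le (measurable_pi_apply j) measurable_const

/-- distributional transform -/
noncomputable def dtr (m : Measure ℝ) (p : ℝ × ℝ) : ℝ :=
  (1 - p.2) * m.real (Set.Iio p.1) + p.2 * m.real (Set.Iic p.1)

theorem dtr_measurable (m : Measure ℝ) [IsProbabilityMeasure m] : Measurable (dtr m) := by
  have h1 : Measurable fun z : ℝ => m.real (Set.Iio z) :=
    Monotone.measurable fun a b h => measureReal_mono (Set.Iio_subset_Iio h)
  have h2 : Measurable fun z : ℝ => m.real (Set.Iic z) :=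
    Monotone.measurable fun a b h => measureReal_mono (Set.Iic_subset_Iic.2 h)
  unfold dtr
  exact ((measurable_const.sub measurable_snd).mul (h1.comp measurable_fst)).add
    (measurable_snd.mul (h2.comp measurable_fst))

theorem dtr_le (m : Measure ℝ) [IsProbabilityMeasure m] (z w : ℝ) (hw : w ∈ Set.Ioo (0:ℝ) 1) :
    dtr m (z, w) ≤ m.real (Set.Iic z) := by
  have h : m.real (Set.Iio z) ≤ m.real (Set.Iic z) := measureReal_mono Set.Iio_subset_Iic_self
  have := mul_le_mul_of_nonneg_left h (sub_nonneg.2 hw.2.le)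
  simp only [dtr]; linarith

theorem le_dtr (m : Measure ℝ) [IsProbabilityMeasure m] (z w : ℝ) (hw : w ∈ Set.Ioo (0:ℝ) 1) :
    m.real (Set.Iio z) ≤ dtr m (z, w) := by
  have h : m.real (Set.Iio z) ≤ m.real (Set.Iic z) := measureReal_mono Set.Iio_subset_Iic_self
  have := mul_le_mul_of_nonneg_left h hw.1.le
  simp only [dtr]; linarith

theorem real_Iic_eq (m : Measure ℝ) [IsProbabilityMeasure m] (z : ℝ) :
    m.real (Set.Iic z) = m.real (Set.Iio z) + m.real {z} := by
  rw [← Set.Iio_union_right, measureReal_union (by simp) (measurableSet_singleton z)]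

theorem snd_Ioo {α : Type*} [MeasurableSpace α] (P : Measure α) [IsProbabilityMeasure P] :
    ∀ᵐ p ∂(P.prod unif01), p.2 ∈ Set.Ioo (0:ℝ) 1 :=
  Measure.quasiMeasurePreserving_snd.ae unif01_Ioo

theorem dtr_aux (m : Measure ℝ) [IsProbabilityMeasure m] {t : ℝ} (ht : t ∈ Set.Ioo (0:ℝ) 1) :
    (m.prod unif01) ((Set.Iio (qf m t)) ×ˢ Set.univ ∪ {qf m t} ×ˢ
      Set.Iic ((t - m.real (Set.Iio (qf m t))) / m.real {qf m t})) = ENNReal.ofReal t := by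
  set z := qf m t
  have ha : m.real (Set.Iio z) ≤ t := real_Iio_qf_le m ht
  have hb : t ≤ m.real (Set.Iic z) := by
    rw [← cdf_eq_real]; exact (qf_le_iff m ht z).1 le_rfl
  rw [real_Iic_eq] at hb
  rw [measure_union _ ((measurableSet_singleton z).prod measurableSet_Iic), Measure.prod_prod,
    Measure.prod_prod, unif01_Iic, measure_univ, mul_one, ← ofReal_measureReal (μ := m),
    ← ofReal_measureReal (μ := m), ← ENNReal.ofReal_mul (by positivity), ← ENNReal.ofReal_add]
  · congr 1
    rcases eq_or_ne (m.real {z}) 0 with h | h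
    · rw [h] at hb ⊢; simp; linarith
    · field_simp; ring
  · positivity
  · exact mul_nonneg (by positivity) (div_nonneg (by linarith) (by positivity))
  · exact div_le_one_of_le₀ (by linarith) (by positivity)
  · rw [Set.disjoint_left]
    rintro ⟨a, b⟩ h1 h2
    simp only [Set.mem_prod, Set.mem_Iio, Set.mem_singleton_iff] at h1 h2
    linarith [h1.1, h2.1]

theorem dtr_ge_meas (m : Measure ℝ) [IsProbabilityMeasure m] {t : ℝ} (ht : t ∈ Set.Ioo (0:ℝ) 1) :
    ENNReal.ofReal t ≤ (m.prod unif01) {p | dtr m p ≤ t} := by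
  rw [← dtr_aux m ht]
  have ha : m.real (Set.Iio (qf m t)) ≤ t := real_Iio_qf_le m ht
  apply measure_mono_ae
  filter_upwards [snd_Ioo m] with p hp
  rintro (⟨h1, -⟩ | ⟨h1, h2⟩)
  · refine (dtr_le m p.1 p.2 hp).trans (le_trans ?_ ha)
    exact measureReal_mono (Set.Iic_subset_Iio.2 h1)
  · obtain ⟨z, w⟩ := p
    simp only [Set.mem_singleton_iff, Set.mem_Iic] at h1 h2
    subst h1
    show (1 - w) * _ + w * _ ≤ t
    rw [real_Iic_eq]
    have : w * m.real {qf m t} ≤ t - m.real (Set.Iio (qf m t)) := by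
      rcases eq_or_ne (m.real {qf m t}) 0 with h | h
      · rw [h]; linarith
      · rwa [← le_div_iff₀ (lt_of_le_of_ne (by positivity) h.symm)]
    linarith

theorem dtr_lt_meas (m : Measure ℝ) [IsProbabilityMeasure m] {t : ℝ} (ht : t ∈ Set.Ioo (0:ℝ) 1) :
    (m.prod unif01) {p | dtr m p < t} ≤ ENNReal.ofReal t := by
  rw [← dtr_aux m ht]
  have hb : t ≤ m.real (Set.Iic (qf m t)) := by
    rw [← cdf_eq_real]; exact (qf_le_iff m ht _).1 le_rfl
  apply measure_mono_ae
  filter_upwards [snd_Ioo m] with p hp h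
  obtain ⟨z, w⟩ := p
  have h : dtr m (z, w) < t := h
  rcases lt_trichotomy z (qf m t) with hz | hz | hz
  · exact Or.inl ⟨hz, trivial⟩
  · right
    refine ⟨hz, ?_⟩
    subst hz
    have h : (1 - w) * m.real (Set.Iio (qf m t)) + w * m.real (Set.Iic (qf m t)) < t := h
    rw [real_Iic_eq] at h hb
    show w ≤ _
    rcases eq_or_ne (m.real {qf m t}) 0 with h' | h'
    · rw [h'] at h hb; linarith
    · rw [le_div_iff₀ (lt_of_le_of_ne (by positivity) h'.symm)]
      linarith
  · exfalso
    have h1 := le_dtr m z w hp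
    have h2 : m.real (Set.Iic (qf m t)) ≤ m.real (Set.Iio z) :=
      measureReal_mono (Set.Iic_subset_Iio.2 hz)
    linarith

theorem dtr_law (m : Measure ℝ) [IsProbabilityMeasure m] :
    (m.prod unif01).map (dtr m) = unif01 := by
  have : IsProbabilityMeasure ((m.prod unif01).map (dtr m)) :=
    Measure.isProbabilityMeasure_map (dtr_measurable m).aemeasurable
  have key : ∀ t ∈ Set.Ioo (0:ℝ) 1, (m.prod unif01) {p | dtr m p ≤ t} = ENNReal.ofReal t := by
    intro t ht
    refine le_antisymm ?_ (dtr_ge_meas m ht)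
    have hlim : Filter.Tendsto ENNReal.ofReal (nhdsWithin t (Set.Ioi t))
        (nhds (ENNReal.ofReal t)) :=
      (ENNReal.continuous_ofReal.tendsto t).mono_left nhdsWithin_le_nhds
    refine ge_of_tendsto hlim ?_
    filter_upwards [Ioo_mem_nhdsGT ht.2] with s hs
    refine le_trans (measure_mono ?_) (dtr_lt_meas m ⟨ht.1.trans hs.1, hs.2⟩)
    intro p hp
    exact lt_of_le_of_lt hp hs.1
  refine Measure.ext_of_Iic _ _ fun t => ?_
  rw [Measure.map_apply (dtr_measurable m) measurableSet_Iic]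
  rcases le_or_gt 1 t with h1 | h1
  · have e1 : unif01 (Set.Iic t) = 1 := by
      rw [← mem_ae_iff_prob_eq_one measurableSet_Iic]
      filter_upwards [unif01_Ioo] with u hu using hu.2.le.trans h1
    rw [e1, ← mem_ae_iff_prob_eq_one (dtr_measurable m measurableSet_Iic)]
    filter_upwards [snd_Ioo m] with p hp
    exact (dtr_le m p.1 p.2 hp).trans (measureReal_le_one.trans h1)
  rw [unif01_Iic h1.le]
  rcases le_or_gt t 0 with h0 | h0
  · rw [ENNReal.ofReal_of_nonpos h0, ← nonpos_iff_eq_zero]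
    have hlim : Filter.Tendsto ENNReal.ofReal (nhdsWithin 0 (Set.Ioi 0))
        (nhds (ENNReal.ofReal 0)) :=
      (ENNReal.continuous_ofReal.tendsto 0).mono_left nhdsWithin_le_nhds
    rw [ENNReal.ofReal_zero] at hlim
    refine ge_of_tendsto hlim ?_
    filter_upwards [Ioo_mem_nhdsGT (zero_lt_one' ℝ)] with s hs
    rw [← key s hs]
    refine measure_mono ?_
    intro p hp
    exact le_trans hp (h0.trans hs.1.le)
  exact key t ⟨h0, h1⟩

theorem map_dtr {Ω : Type*} [MeasurableSpace Ω] (P : Measure Ω) [IsProbabilityMeasure P]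
    {Z : Ω → ℝ} (hZ : Measurable Z) :
    (P.prod unif01).map (fun p => dtr (P.map Z) (Z p.1, p.2)) = unif01 := by
  have : IsProbabilityMeasure (P.map Z) := Measure.isProbabilityMeasure_map hZ.aemeasurable
  conv_rhs => rw [← dtr_law (P.map Z)]
  have h : (P.map Z).prod unif01 = (P.prod unif01).map (Prod.map Z id) := by
    rw [← Measure.map_prod_map _ _ hZ measurable_id, Measure.map_id]
  conv_rhs => rw [h]
  rw [Measure.map_map (dtr_measurable _) (hZ.prodMap measurable_id)]
  rfl

theorem dtr_sets {Ω : Type*} [MeasurableSpace Ω] (P : Measure Ω) [IsProbabilityMeasure P]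
    {Z X : Ω → ℝ} (hZ : Measurable Z) (hX : Measurable X)
    (h : ∀ᵐ z ∂(P.prod P), Z z.2 ≤ Z z.1 → X z.2 ≤ X z.1) (x : ℝ) :
    ∀ᵐ p ∂(P.prod unif01), (dtr (P.map Z) (Z p.1, p.2) ≤ cdf (P.map X) x ↔ X p.1 ≤ x) := by
  have : IsProbabilityMeasure (P.map Z) := Measure.isProbabilityMeasure_map hZ.aemeasurable
  have : IsProbabilityMeasure (P.map X) := Measure.isProbabilityMeasure_map hX.aemeasurable
  have hU : Measurable (fun p : Ω × ℝ => dtr (P.map Z) (Z p.1, p.2)) :=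
    (dtr_measurable _).comp ((hZ.comp measurable_fst).prodMk measurable_snd)
  have e1 : (P.prod unif01) {p | dtr (P.map Z) (Z p.1, p.2) ≤ cdf (P.map X) x} =
      ENNReal.ofReal (cdf (P.map X) x) := by
    rw [← unif01_Iic (cdf_le_one _ _)]
    conv_rhs => rw [← map_dtr P hZ]
    rw [Measure.map_apply hU measurableSet_Iic]
    rfl
  have e2 : (P.prod unif01) {p | X p.1 ≤ x} = ENNReal.ofReal (cdf (P.map X) x) := by
    rw [ofReal_cdf, Measure.map_apply hX measurableSet_Iic]
    have : {p : Ω × ℝ | X p.1 ≤ x} = (X ⁻¹' Set.Iic x) ×ˢ Set.univ := by ext; simp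
    rw [this, Measure.prod_prod, measure_univ, mul_one]
  have hsub : {p : Ω × ℝ | X p.1 ≤ x} ≤ᵐ[P.prod unif01]
      {p | dtr (P.map Z) (Z p.1, p.2) ≤ cdf (P.map X) x} := by
    have h' := Measure.quasiMeasurePreserving_fst (μ := P) (ν := unif01)
      |>.ae (Measure.ae_ae_of_ae_prod h)
    filter_upwards [h', snd_Ioo P] with p hp hw hx
    have hx : X p.1 ≤ x := hx
    show dtr (P.map Z) (Z p.1, p.2) ≤ cdf (P.map X) x
    refine (dtr_le _ _ _ hw).trans ?_
    rw [cdf_eq_real, map_measureReal_apply hX measurableSet_Iic,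
      map_measureReal_apply hZ measurableSet_Iic]
    refine ENNReal.toReal_mono (measure_ne_top _ _) (measure_mono_ae ?_)
    filter_upwards [hp] with ω hω hz
    exact (hω hz).trans hx
  have := ae_eq_of_ae_subset_of_measure_ge hsub (by rw [e1, e2])
    (measurableSet_le (hX.comp measurable_fst) measurable_const).nullMeasurableSet
    (measure_ne_top _ _)
  filter_upwards [this] with p hp
  exact (iff_of_eq hp).symm

theorem backward_sklar {I : Type u} {Ω : Type*} [MeasurableSpace Ω] (P : Measure Ω)
    [IsProbabilityMeasure P] {Z X : Ω → I → ℝ} (hZ : Measurable Z) (hX : Measurable X)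
    (h : ∀ i, ∀ᵐ z ∂(P.prod P), Z z.2 i ≤ Z z.1 i → X z.2 i ≤ X z.1 i)
    (hU : Measurable (fun (p : Ω × ℝ) i => dtr (P.map (fun ω => Z ω i)) (Z p.1 i, p.2))) :
    SklarRel ((P.prod unif01).map
      (fun (p : Ω × ℝ) i => dtr (P.map (fun ω => Z ω i)) (Z p.1 i, p.2))) (P.map X) := by
  intro J x
  have hms : ∀ y : I → ℝ, MeasurableSet {ω : I → ℝ | ∀ j ∈ J, ω j ≤ y j} := by
    intro y
    have : {ω : I → ℝ | ∀ j ∈ J, ω j ≤ y j} = ⋂ j ∈ J, {ω | ω j ≤ y j} := by ext; simp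
    rw [this]
    exact Finset.measurableSet_biInter _ fun j _ =>
        measurableSet_le (measurable_pi_apply j) measurable_const
  have hmm : ∀ j, (P.map X).map (fun ω => ω j) = P.map (fun ω => X ω j) := fun j => by
    rw [Measure.map_map (measurable_pi_apply j) hX]; rfl
  simp only [hmm]
  rw [Measure.map_apply hU (hms _), Measure.map_apply hX (hms _)]
  have e : P (X ⁻¹' {ω | ∀ j ∈ J, ω j ≤ x j}) =
      (P.prod unif01) ((X ⁻¹' {ω | ∀ j ∈ J, ω j ≤ x j}) ×ˢ Set.univ) := by
    rw [Measure.prod_prod, measure_univ, mul_one]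
  rw [e]
  apply measure_congr
  have : ∀ᵐ p ∂(P.prod unif01), ∀ j ∈ J, (dtr (P.map (fun ω => Z ω j)) (Z p.1 j, p.2) ≤
      cdf (P.map (fun ω => X ω j)) (x j) ↔ X p.1 j ≤ x j) := by
    rw [Filter.eventually_all_finset]
    intro j _
    exact dtr_sets P ((measurable_pi_apply j).comp hZ) ((measurable_pi_apply j).comp hX) (h j) _
  filter_upwards [this] with p hp
  apply propext
  show (∀ j ∈ J, _) ↔ ((∀ j ∈ J, _) ∧ True)
  rw [and_true]
  exact forall₂_congr hp

/-- Two probability measures `μ` and `ν` on `ℝ^I` have a common underlying copula measure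
if and only if there exist, on a common probability space, processes `X ∼ μ` and `Y ∼ ν`
such that `X_i` and `Y_i` are similarly ordered for every `i ∈ I`, i.e.
`(X_i(ω) − X_i(ω'))·(Y_i(ω) − Y_i(ω')) ≥ 0` for `ℙ ⊗ ℙ`-almost every `(ω, ω')`. -/
theorem common_copula_iff_similarly_ordered {I : Type u} (μ ν : Measure (I → ℝ))
    [IsProbabilityMeasure μ] [IsProbabilityMeasure ν] :
    (∃ C : Measure (I → ℝ), IsCopulaMeasure C ∧ SklarRel C μ ∧ SklarRel C ν) ↔
      ∃ (Ω : Type u) (_ : MeasurableSpace Ω) (P : Measure Ω) (_ : IsProbabilityMeasure P)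
        (X Y : Ω → I → ℝ), Measurable X ∧ Measurable Y ∧
          P.map X = μ ∧ P.map Y = ν ∧
          ∀ i : I, ∀ᵐ z ∂(P.prod P), 0 ≤ (X z.1 i - X z.2 i) * (Y z.1 i - Y z.2 i) := by
  constructor
  · rintro ⟨C, hC, h1, h2⟩
    have hm : ∀ ρ : Measure (I → ℝ),
        Measurable (fun (u : I → ℝ) i => qf (ρ.map (fun ω => ω i)) (u i)) := fun ρ =>
      measurable_pi_lambda _ fun i => (qf_measurable _).comp (measurable_pi_apply i)
    have := hC.1
    refine ⟨I → ℝ, inferInstance, C, hC.1, _, _, hm μ, hm ν, forward_law C μ hC h1,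
      forward_law C ν hC h2, fun i => ?_⟩
    have hi : ∀ᵐ u ∂C, u i ∈ Set.Ioo (0:ℝ) 1 := by
      have := unif01_Ioo
      rw [← hC.2 i] at this
      exact ae_of_ae_map (measurable_pi_apply i).aemeasurable this
    filter_upwards [Measure.quasiMeasurePreserving_fst.ae hi,
      Measure.quasiMeasurePreserving_snd.ae hi] with z ha hb
    rcases le_total (z.1 i) (z.2 i) with h | h
    · exact mul_nonneg_of_nonpos_of_nonpos (sub_nonpos.2 (qf_mono _ ha hb h))
        (sub_nonpos.2 (qf_mono _ ha hb h))
    · exact mul_nonneg (sub_nonneg.2 (qf_mono _ hb ha h)) (sub_nonneg.2 (qf_mono _ hb ha h))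
  · rintro ⟨Ω, _, P, _, X, Y, hX, hY, rfl, rfl, h⟩
    have hZ : Measurable (fun ω i => X ω i + Y ω i) :=
      measurable_pi_lambda _ fun i =>
        ((measurable_pi_apply i).comp hX).add ((measurable_pi_apply i).comp hY)
    have hZi : ∀ i, Measurable (fun ω => X ω i + Y ω i) := fun i =>
        ((measurable_pi_apply i).comp hX).add ((measurable_pi_apply i).comp hY)
    have hU : Measurable (fun (p : Ω × ℝ) i =>
        dtr (P.map (fun ω => X ω i + Y ω i)) (X p.1 i + Y p.1 i, p.2)) := by
      refine measurable_pi_lambda _ fun i => ?_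
      have : IsProbabilityMeasure (P.map (fun ω => X ω i + Y ω i)) :=
        Measure.isProbabilityMeasure_map (hZi i).aemeasurable
      exact (dtr_measurable _).comp (((hZi i).comp measurable_fst).prodMk measurable_snd)
    refine ⟨_, ⟨Measure.isProbabilityMeasure_map hU.aemeasurable, fun i => ?_⟩,
      backward_sklar P hZ hX (fun i => ?_) hU, backward_sklar P hZ hY (fun i => ?_) hU⟩
    · rw [Measure.map_map (measurable_pi_apply i) hU]
      exact map_dtr P (hZi i)
    · filter_upwards [h i] with z hz hle
      by_contra! hc
      nlinarith
    · filter_upwards [h i] with z hz hle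
      by_contra! hc
      nlinarith
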